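/- Let R be a commutative Noetherian ring, I an ideal, and M, N finitely generated R-modules such that R/(I + ann_R M + ann_R N) is Artinian. Then for every i ≥ 0 and every n ≥ 1 the module Ext_R^i(N/I^n N, M) has finite length, and for each i there exists a polynomial p_i with rational coefficients such that λ(Ext_R^i(N/I^n N, M)) = p_i(n) for all sufficiently large n. -/

import Mathlib

set_option synthInstance.maxHeartbeats 1000000

open CategoryTheory

universe u

/-- The length `λ(M)` of a module `M`, realized as the Krull dimension of the lattice of
submodules of `M`. -/
noncomputable def moduleLength (R M : Type*) [Ring R] [AddCommGroup M] [Module R M] :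
    WithBot ℕ∞ :=
  Order.krullDim (Submodule R M)

/-- `Ext_R^i(A, B)`, as an `R`-module. -/
noncomputable abbrev extModule (R : Type u) [CommRing R] (i : ℕ) (A B : Type u)
    [AddCommGroup A] [Module R A] [AddCommGroup B] [Module R B] : Type u :=
  ↥(((Ext R (ModuleCat.{u} R) i).obj (Opposite.op (ModuleCat.of R A))).obj (ModuleCat.of R B))

/-! ### Eventually polynomial sequences -/

/-- A sequence of rationals that agrees with a polynomial from some index on. -/
def EventuallyPolynomial (f : ℕ → ℚ) : Prop :=
  ∃ (p : Polynomial ℚ) (N : ℕ), ∀ n ≥ N, f n = p.eval (n : ℚ)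

namespace EventuallyPolynomial

variable {f g : ℕ → ℚ}

lemma of_eventually_eq (hg : EventuallyPolynomial g) (N : ℕ) (h : ∀ n ≥ N, f n = g n) :
    EventuallyPolynomial f := by
  obtain ⟨p, m, hp⟩ := hg
  exact ⟨p, max N m, fun n hn => by
    rw [h n (le_trans (le_max_left _ _) hn), hp n (le_trans (le_max_right _ _) hn)]⟩

lemma sub (hf : EventuallyPolynomial f) (hg : EventuallyPolynomial g) :
    EventuallyPolynomial fun n => f n - g n := by
  obtain ⟨p, m, hp⟩ := hf
  obtain ⟨q, k, hq⟩ := hg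
  exact ⟨p - q, max m k, fun n hn => by
    change f n - g n = _
    rw [hp n (le_trans (le_max_left _ _) hn), hq n (le_trans (le_max_right _ _) hn),
      Polynomial.eval_sub]⟩

/-- The forward difference operator is surjective on rational polynomials. -/
lemma exists_forward_difference_eq (p : Polynomial ℚ) :
    ∃ q : Polynomial ℚ, ∀ x : ℚ, q.eval (x + 1) - q.eval x = p.eval x := by
  induction p using Polynomial.induction_on' with
  | add p₁ p₂ h₁ h₂ =>
    obtain ⟨q₁, h₁⟩ := h₁
    obtain ⟨q₂, h₂⟩ := h₂
    refine ⟨q₁ + q₂, fun x => ?_⟩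
    simp only [Polynomial.eval_add, ← h₁, ← h₂]
    ring
  | monomial k c =>
    refine ⟨Polynomial.C (c / (k + 1)) * Polynomial.bernoulli (k + 1), fun x => ?_⟩
    have hk : (k : ℚ) + 1 ≠ 0 := by positivity
    rw [Polynomial.eval_mul, Polynomial.eval_mul, add_comm x 1,
      Polynomial.bernoulli_eval_one_add]
    simp only [Polynomial.eval_C, Polynomial.eval_monomial]
    push_cast
    field_simp
    ring

lemma of_forward_difference (h : EventuallyPolynomial fun n => f (n + 1) - f n) :
    EventuallyPolynomial f := by
  obtain ⟨p, m, hp⟩ := h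
  obtain ⟨q, hq⟩ := exists_forward_difference_eq p
  refine ⟨q + Polynomial.C (f m - q.eval (m : ℚ)), m, fun n hn => ?_⟩
  induction n, hn using Nat.le_induction with
  | base => simp
  | succ n hn ih =>
    have h₁ := hp n hn
    have h₂ := hq n
    simp only [Polynomial.eval_add, Polynomial.eval_C] at ih ⊢
    push_cast
    linarith

end EventuallyPolynomial

/-! ### Chain conditions on sequences -/

/-- Antitone sequences in a partial order with the descending chain condition satisfy the
descending chain condition for the pointwise order. -/
lemma wellFoundedLT_antitone {α : Type*} [PartialOrder α] [WellFoundedLT α] :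
    WellFoundedLT {f : ℕ → α // Antitone f} := by
  have stab (G : ℕ → α) (hG : Antitone G) : ∃ n, ∀ m, n ≤ m → G n = G m :=
    WellFoundedGT.monotone_chain_condition (α := αᵒᵈ) ⟨fun n => OrderDual.toDual (G n), hG⟩
  refine ⟨(RelEmbedding.wellFounded_iff_isEmpty).2 ⟨fun e => ?_⟩⟩
  have hanti : StrictAnti e := strictAnti_nat_of_succ_lt fun n => e.map_rel_iff.2 n.lt_succ_self
  have hle {k l : ℕ} (h : k ≤ l) (d : ℕ) : (e l).1 d ≤ (e k).1 d := hanti.antitone h d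
  obtain ⟨m, hm⟩ := stab (fun k => (e k).1 k) fun k l h =>
    (hle h l).trans ((e k).2 h)
  choose c hc using fun d => stab (fun k => (e k).1 d) fun k l h => hle h d
  set N := max m ((Finset.range m).sup c) with hN
  have key : e (N + 1) = e N := by
    have large {k d : ℕ} (hk : m ≤ k) (hd : m ≤ d) : (e k).1 d = (e m).1 m := by
      apply le_antisymm
      · exact (hle hk d).trans ((e m).2 hd)
      · have := hm (max k d) (hk.trans (le_max_left _ _))
        rw [this]
        exact (hle (le_max_left k d) _).trans ((e k).2 (le_max_right k d))
    ext d
    by_cases hd : d < m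
    · have : c d ≤ N := (Finset.le_sup (Finset.mem_range.2 hd)).trans (le_max_right _ _)
      exact (hc d _ (this.trans N.le_succ)).symm.trans (hc d _ this)
    · push Not at hd
      rw [large (le_max_left _ _) hd, large ((le_max_left _ _).trans N.le_succ) hd]
  exact (hanti N.lt_succ_self).ne key

/-! ### Lowering modules -/

universe v w

/-- A sequence of `R`-modules with commuting operators of degree `-1`: a graded module over the
polynomial ring `R[ι]` on which the variables lower degrees. -/
structure LoweringModule (R : Type v) [CommRing R] (ι : Type w) where
  /-- The component of a given degree. -/
  X : ℕ → Type u
  [addCommGroup : ∀ n, AddCommGroup (X n)]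
  [module : ∀ n, Module R (X n)]
  /-- The action of the variables. -/
  T : ι → ∀ n, X (n + 1) →ₗ[R] X n
  comm : ∀ a b n x, T a n (T b (n + 1) x) = T b n (T a (n + 1) x)

namespace LoweringModule

attribute [instance] LoweringModule.addCommGroup LoweringModule.module

variable {R : Type v} [CommRing R] {ι : Type w}

/-- Graded submodules stable under the operators indexed by `s`. -/
def Stable (A : LoweringModule.{u} R ι) (s : Finset ι) : Type _ :=
  {Z : ∀ n, Submodule R (A.X n) // ∀ a ∈ s, ∀ n, Z (n + 1) ≤ (Z n).comap (A.T a n)}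

instance (A : LoweringModule.{u} R ι) (s : Finset ι) : PartialOrder (A.Stable s) :=
  inferInstanceAs (PartialOrder
    {Z : ∀ n, Submodule R (A.X n) // ∀ a ∈ s, ∀ n, Z (n + 1) ≤ (Z n).comap (A.T a n)})

/-- The descending chain condition on graded submodules stable under `s`. -/
def IsArt (A : LoweringModule.{u} R ι) (s : Finset ι) : Prop := WellFoundedLT (A.Stable s)

/-- The graded submodule given by a family of submodules. -/
def sub (A : LoweringModule.{u} R ι) (K : ∀ n, Submodule R (A.X n))
    (hK : ∀ a n, K (n + 1) ≤ (K n).comap (A.T a n)) : LoweringModule R ι where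
  X n := K n
  T a n := (A.T a n).restrict (hK a n)
  comm a b n x := Subtype.ext (A.comm a b n x)

/-- The kernels of one of the operators. -/
def kerShift (A : LoweringModule.{u} R ι) (a : ι) : LoweringModule R ι where
  X n := LinearMap.ker (A.T a n)
  T b n := (A.T b (n + 1)).restrict fun x hx => by
    rw [LinearMap.mem_ker] at hx ⊢
    rw [A.comm, hx, map_zero]
  comm b c n x := Subtype.ext (A.comm b c (n + 1) x)

/-- The cokernels of one of the operators. -/
def coker (A : LoweringModule.{u} R ι) (a : ι) : LoweringModule R ι where
  X n := A.X n ⧸ LinearMap.range (A.T a n)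
  T b n := Submodule.mapQ _ _ (A.T b n) (by
    rintro _ ⟨x, rfl⟩
    exact ⟨A.T b (n + 1) x, A.comm _ _ _ _⟩)
  comm b c n x := by
    obtain ⟨x, rfl⟩ := Submodule.mkQ_surjective _ x
    exact congrArg (Submodule.mkQ _) (A.comm b c n x)

/-- The zero graded module. -/
def zero (R : Type v) [CommRing R] (ι : Type w) : LoweringModule.{u} R ι where
  X _ := PUnit
  T _ _ := 0
  comm _ _ _ _ := rfl

variable {A B C : LoweringModule.{u} R ι} {s : Finset ι} {a : ι}

lemma isArt_of_eventually_subsingleton [∀ n, IsArtinian R (A.X n)] (N : ℕ)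
    (h : ∀ n ≥ N, Subsingleton (A.X n)) : A.IsArt s := by
  let e : A.Stable s → ∀ n : Fin N, Submodule R (A.X n) := fun Z n => Z.1 n
  have he : StrictMono e := by
    refine Monotone.strictMono_of_injective (fun Z Z' h n => h n) fun Z Z' hZ => ?_
    refine Subtype.ext (funext fun n => ?_)
    by_cases hn : n < N
    · exact congrFun hZ ⟨n, hn⟩
    · have := h n (not_lt.1 hn)
      exact Subsingleton.elim _ _
  exact he.wellFoundedLT

lemma isArt_zero : (zero.{u} R ι).IsArt s :=
  have : ∀ n, IsArtinian R ((zero.{u} R ι).X n) := fun _ => inferInstanceAs (IsArtinian R PUnit.{u + 1})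
  isArt_of_eventually_subsingleton 0 fun _ _ => inferInstanceAs (Subsingleton PUnit.{u + 1})

lemma IsArt.of_exact (hA : A.IsArt s) (hC : C.IsArt s)
    (f : ∀ n, A.X n →ₗ[R] B.X n) (g : ∀ n, B.X n →ₗ[R] C.X n)
    (hf : ∀ a n x, f n (A.T a n x) = B.T a n (f (n + 1) x))
    (hg : ∀ a n x, g n (B.T a n x) = C.T a n (g (n + 1) x))
    (hex : ∀ n, LinearMap.ker (g n) ≤ LinearMap.range (f n)) : B.IsArt s := by
  have : WellFoundedLT (A.Stable s) := hA
  have : WellFoundedLT (C.Stable s) := hC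
  let e : B.Stable s → A.Stable s × C.Stable s := fun Z =>
    (⟨fun n => (Z.1 n).comap (f n), fun a ha n x hx => by
        change f n (A.T a n x) ∈ Z.1 n
        rw [hf]
        exact Z.2 a ha n hx⟩,
      ⟨fun n => (Z.1 n).map (g n), by
        rintro a ha n _ ⟨x, hx, rfl⟩
        exact ⟨B.T a n x, Z.2 a ha n hx, hg a n x⟩⟩)
  have he : StrictMono e := by
    intro Z Z' hlt
    refine lt_of_le_of_ne ⟨fun n => Submodule.comap_mono (hlt.le n),
      fun n => Submodule.map_mono (hlt.le n)⟩ fun heq => hlt.not_ge fun n x hx => ?_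
    have h₁ : (Z.1 n).comap (f n) = (Z'.1 n).comap (f n) :=
      congrFun (congrArg (fun p => p.1.1) heq) n
    have h₂ : (Z.1 n).map (g n) = (Z'.1 n).map (g n) :=
      congrFun (congrArg (fun p => p.2.1) heq) n
    obtain ⟨z, hz, hzx⟩ : g n x ∈ (Z.1 n).map (g n) := h₂ ▸ ⟨x, hx, rfl⟩
    obtain ⟨y, hy⟩ := hex n (show x - z ∈ LinearMap.ker (g n) by simp [hzx])
    have : y ∈ (Z.1 n).comap (f n) := by
      rw [h₁, Submodule.mem_comap, hy]
      exact sub_mem hx (hlt.le n hz)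
    have := (Z.1 n).add_mem (show f n y ∈ Z.1 n from this) hz
    rwa [hy, sub_add_cancel] at this
  exact he.wellFoundedLT

lemma IsArt.of_surjective (hA : A.IsArt s) (f : ∀ n, A.X n →ₗ[R] B.X n)
    (hf : ∀ a n x, f n (A.T a n x) = B.T a n (f (n + 1) x))
    (hs : ∀ n, Function.Surjective (f n)) : B.IsArt s :=
  hA.of_exact (isArt_zero) f (fun _ => 0) hf (fun _ _ _ => rfl)
    fun n x _ => hs n x

lemma IsArt.of_injective (hA : A.IsArt s) (f : ∀ n, B.X n →ₗ[R] A.X n)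
    (hf : ∀ a n x, f n (B.T a n x) = A.T a n (f (n + 1) x))
    (hs : ∀ n, Function.Injective (f n)) : B.IsArt s :=
  isArt_zero.of_exact hA (fun _ => 0) f (fun _ _ _ => (map_zero _).symm) hf fun n x hx => by
    rw [LinearMap.ker_eq_bot.2 (hs n)] at hx
    rw [(Submodule.mem_bot R).1 hx]
    exact zero_mem _

variable [DecidableEq ι]

lemma IsArt.kerShift (hA : A.IsArt (insert a s)) : (A.kerShift a).IsArt s := by
  have : WellFoundedLT (A.Stable (insert a s)) := hA
  let e : (A.kerShift a).Stable s → A.Stable (insert a s) := fun Z =>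
    ⟨fun n => match n with
      | 0 => ⊤
      | n + 1 => (Z.1 n).map (LinearMap.ker (A.T a n)).subtype, by
        rintro b hb (_ | n)
        · exact fun _ _ => trivial
        · rintro _ ⟨x, hx, rfl⟩
          rcases Finset.mem_insert.1 hb with rfl | hb
          · have h0 : A.T b (n + 1) x.1 = 0 := x.2
            change A.T b (n + 1) x.1 ∈ (Z.1 n).map (LinearMap.ker (A.T b n)).subtype
            rw [h0]
            exact zero_mem _
          · exact ⟨_, Z.2 b hb n hx, rfl⟩⟩
  have he : StrictMono e := by
    refine Monotone.strictMono_of_injective ?_ fun Z Z' hZ => ?_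
    · rintro Z Z' h (_ | n)
      · exact le_rfl
      · exact Submodule.map_mono (h n)
    · refine Subtype.ext (funext fun n => ?_)
      exact Submodule.map_injective_of_injective (Submodule.subtype_injective _)
        (congrFun (congrArg Subtype.val hZ) (n + 1))
  exact he.wellFoundedLT

lemma IsArt.coker (hA : A.IsArt (insert a s)) : (A.coker a).IsArt s := by
  have : WellFoundedLT (A.Stable (insert a s)) := hA
  let e : (A.coker a).Stable s → A.Stable (insert a s) := fun Z =>
    ⟨fun n => (Z.1 n).comap (LinearMap.range (A.T a n)).mkQ, by
      intro b hb n x hx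
      rcases Finset.mem_insert.1 hb with rfl | hb
      · have h0 : (LinearMap.range (A.T b n)).mkQ (A.T b n x) = 0 :=
          (Submodule.Quotient.mk_eq_zero _).2 ⟨x, rfl⟩
        change (LinearMap.range (A.T b n)).mkQ (A.T b n x) ∈ Z.1 n
        rw [h0]
        exact zero_mem _
      · exact Z.2 b hb n hx⟩
  have he : StrictMono e := by
    refine Monotone.strictMono_of_injective (fun Z Z' h n => Submodule.comap_mono (h n))
      fun Z Z' hZ => ?_
    refine Subtype.ext (funext fun n => ?_)
    exact Submodule.comap_injective_of_surjective (Submodule.mkQ_surjective _)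
      (congrFun (congrArg Subtype.val hZ) n)
  exact he.wellFoundedLT

/-- If the kernels of an operator satisfy the descending chain condition with respect to the
remaining operators, then the whole graded module satisfies it. -/
lemma IsArt.of_kerShift [IsArtinian R (A.X 0)] (hK : (A.kerShift a).IsArt s) :
    A.IsArt (insert a s) := by
  have : WellFoundedLT ((A.kerShift a).Stable s) := hK
  -- the image of a graded submodule under the operator `a`
  let D : A.Stable (insert a s) → A.Stable (insert a s) := fun Z =>
    ⟨fun n => (Z.1 (n + 1)).map (A.T a n), by
      rintro b hb n _ ⟨x, hx, rfl⟩
      exact ⟨A.T b (n + 1) x, Z.2 b hb (n + 1) hx, A.comm a b n x⟩⟩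
  have hDmono : Monotone D := fun Z Z' h n => Submodule.map_mono (h (n + 1))
  have hDle (Z) : D Z ≤ Z := fun n =>
    Submodule.map_le_iff_le_comap.2 (Z.2 a (Finset.mem_insert_self _ _) n)
  -- the part of a graded submodule that is killed by the operator `a`
  let q : A.Stable (insert a s) → Submodule R (A.X 0) × (A.kerShift a).Stable s := fun Z =>
    (Z.1 0, ⟨fun n => (Z.1 (n + 1)).comap (LinearMap.ker (A.T a n)).subtype,
      fun b hb n x hx => Z.2 b (Finset.mem_insert_of_mem hb) (n + 1) hx⟩)
  have hqmono : Monotone q := fun Z Z' h => ⟨h 0, fun n => Submodule.comap_mono (h (n + 1))⟩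
  have key (n : ℕ) : ∀ Z Z' : A.Stable (insert a s), Z ≤ Z' →
      (∀ d, q (D^[d] Z) = q (D^[d] Z')) → Z.1 n = Z'.1 n := by
    induction n with
    | zero => exact fun Z Z' _ hq => congrArg Prod.fst (hq 0)
    | succ n ih =>
      intro Z Z' hle hq
      refine le_antisymm (hle (n + 1)) fun x hx => ?_
      have h₁ : (D Z).1 n = (D Z').1 n := ih _ _ (hDmono hle) fun d => hq (d + 1)
      have h₂ : (Z.1 (n + 1)).comap (LinearMap.ker (A.T a n)).subtype =
          (Z'.1 (n + 1)).comap (LinearMap.ker (A.T a n)).subtype :=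
        congrFun (congrArg (fun p => p.2.1) (hq 0)) n
      obtain ⟨z, hz, hzx⟩ : A.T a n x ∈ (D Z).1 n := h₁ ▸ ⟨x, hx, rfl⟩
      have hker : x - z ∈ LinearMap.ker (A.T a n) := by simp [hzx]
      have : (⟨x - z, hker⟩ : LinearMap.ker (A.T a n)) ∈
          (Z.1 (n + 1)).comap (LinearMap.ker (A.T a n)).subtype := by
        rw [h₂]
        exact sub_mem hx (hle (n + 1) hz)
      have := (Z.1 (n + 1)).add_mem (show x - z ∈ Z.1 (n + 1) from this) hz
      rwa [sub_add_cancel] at this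
  have := wellFoundedLT_antitone (α := Submodule R (A.X 0) × (A.kerShift a).Stable s)
  let e : A.Stable (insert a s) →
      {f : ℕ → Submodule R (A.X 0) × (A.kerShift a).Stable s // Antitone f} := fun Z =>
    ⟨fun d => q (D^[d] Z), antitone_nat_of_succ_le fun d => hqmono (by
      rw [Function.iterate_succ_apply']
      exact hDle _)⟩
  have he : StrictMono e := by
    intro Z Z' hlt
    refine lt_of_le_of_ne (fun d => hqmono (hDmono.iterate d hlt.le)) fun heq => hlt.ne ?_
    exact Subtype.ext (funext fun n => key n Z Z' hlt.le
      fun d => congrFun (congrArg Subtype.val heq) d)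
  exact he.wellFoundedLT

/-- The length of a component, as a rational number. -/
noncomputable def hilbert (A : LoweringModule.{u} R ι) (n : ℕ) : ℚ :=
  ((Module.length R (A.X n)).toNat : ℚ)

lemma hilbert_add_of_exact {X₁ X₂ X₃ : Type*} [AddCommGroup X₁] [AddCommGroup X₂]
    [AddCommGroup X₃] [Module R X₁] [Module R X₂] [Module R X₃]
    (h₂ : IsFiniteLength R X₂) (f : X₁ →ₗ[R] X₂) (g : X₂ →ₗ[R] X₃)
    (hf : Function.Injective f) (hg : Function.Surjective g) (h : Function.Exact f g) :
    ((Module.length R X₂).toNat : ℚ) =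
      (Module.length R X₁).toNat + (Module.length R X₃).toNat := by
  have e := Module.length_eq_add_of_exact f g hf hg h
  have h₂ := Module.length_ne_top_iff.2 h₂
  rw [e] at h₂ ⊢
  rw [ENat.toNat_add (fun h => h₂ (by simp [h])) (fun h => h₂ (by simp [h]))]
  push_cast
  rfl

/-- **Hilbert's theorem** for graded modules with the descending chain condition. -/
theorem IsArt.eventuallyPolynomial (hA : A.IsArt s) (hfin : ∀ n, IsFiniteLength R (A.X n)) :
    EventuallyPolynomial A.hilbert := by
  induction s using Finset.induction_on generalizing A with
  | empty =>
    have : WellFoundedLT (A.Stable ∅) := hA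
    let Z : ℕ → (A.Stable ∅) := fun k =>
      ⟨fun n => if n < k then ⊥ else ⊤, fun a ha => absurd ha (Finset.notMem_empty a)⟩
    have hZ : Antitone Z := by
      intro k l h n
      change (if n < l then (⊥ : Submodule R (A.X n)) else ⊤) ≤ if n < k then ⊥ else ⊤
      split_ifs <;> first | exact bot_le | exact le_top | omega
    obtain ⟨N, hN⟩ := WellFoundedGT.monotone_chain_condition (α := (A.Stable ∅)ᵒᵈ)
      ⟨fun n => OrderDual.toDual (Z n), hZ⟩
    refine ⟨0, N, fun n hn => ?_⟩
    have h : (if n < N then (⊥ : Submodule R (A.X n)) else ⊤) = if n < n + 1 then ⊥ else ⊤ :=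
      congrFun (congrArg Subtype.val (hN (n + 1) (by omega))) n
    rw [if_neg (by omega), if_pos (by omega)] at h
    have : Subsingleton (A.X n) := (Submodule.subsingleton_iff R).1 (subsingleton_of_bot_eq_top h.symm)
    simp [hilbert, Module.length_eq_zero]
  | insert a s _ ih =>
    have hker : EventuallyPolynomial (A.kerShift a).hilbert := ih hA.kerShift fun n =>
      (hfin (n + 1)).of_injective (Submodule.subtype_injective _)
    have hcoker : EventuallyPolynomial (A.coker a).hilbert := ih hA.coker fun n =>
      (hfin n).of_surjective (Submodule.mkQ_surjective _)
    refine .of_forward_difference ((hker.sub hcoker).of_eventually_eq 0 fun n _ => ?_)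
    have h₁ := hilbert_add_of_exact (hfin (n + 1)) (LinearMap.ker (A.T a n)).subtype
      (A.T a n).rangeRestrict (Submodule.subtype_injective _) (A.T a n).surjective_rangeRestrict
      (LinearMap.exact_iff.2 (by simp))
    have h₂ := hilbert_add_of_exact (hfin n) (LinearMap.range (A.T a n)).subtype
      (LinearMap.range (A.T a n)).mkQ (Submodule.subtype_injective _)
      (Submodule.mkQ_surjective _) (LinearMap.exact_iff.2 (by simp))
    change (A.hilbert (n + 1) : ℚ) = (A.kerShift a).hilbert n + _ at h₁
    change (A.hilbert n : ℚ) = _ + (A.coker a).hilbert n at h₂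
    linarith

end LoweringModule

/-! ### The contravariant long exact sequence for modules -/

open Abelian in
/-- `Ext_R^i(A, M)` as a module, computed in the derived category. -/
abbrev ModuleExt (R : Type u) [CommRing R] (M : Type u) [AddCommGroup M] [Module R M] (i : ℕ)
    (A : Type u) [AddCommGroup A] [Module R A] : Type u :=
  Abelian.Ext (ModuleCat.of R A) (ModuleCat.of R M) i

namespace ModuleExt

section

variable {R : Type u} [CommRing R] (M : Type u) [AddCommGroup M] [Module R M] (i : ℕ)
  {A B C : Type u} [AddCommGroup A] [AddCommGroup B] [AddCommGroup C]
  [Module R A] [Module R B] [Module R C]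

/-- Contravariant functoriality of `Ext`. -/
noncomputable def map (f : A →ₗ[R] B) : ModuleExt R M i B →ₗ[R] ModuleExt R M i A :=
  Abelian.Ext.bilinearCompOfLinear R _ _ _ 0 i i (zero_add i)
    (Abelian.Ext.mk₀ (ModuleCat.ofHom f))

lemma map_apply (f : A →ₗ[R] B) (x : ModuleExt R M i B) :
    map M i f x = (Abelian.Ext.mk₀ (ModuleCat.ofHom f)).comp x (zero_add i) := rfl

lemma map_map (f : A →ₗ[R] B) (g : B →ₗ[R] C) (x : ModuleExt R M i C) :
    map M i f (map M i g x) = map M i (g ∘ₗ f) x := by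
  simp [map_apply, ModuleCat.ofHom_comp]

lemma smul_eq_map (r : R) (x : ModuleExt R M i A) :
    r • x = map M i (r • LinearMap.id : A →ₗ[R] A) x := by
  have : ModuleCat.ofHom (r • LinearMap.id : A →ₗ[R] A) = r • 𝟙 (ModuleCat.of R A) := rfl
  rw [map_apply, this, Abelian.Ext.mk₀_smul, Abelian.Ext.smul_comp, Abelian.Ext.mk₀_id_comp]

lemma smul_eq_zero_of_source {r : R} (hr : ∀ y : A, r • y = 0) (x : ModuleExt R M i A) :
    r • x = 0 := by
  have : (r • LinearMap.id : A →ₗ[R] A) = 0 := LinearMap.ext hr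
  have h0 : ModuleCat.ofHom (0 : A →ₗ[R] A) = 0 := rfl
  rw [smul_eq_map, this, map_apply, h0, Abelian.Ext.mk₀_zero, Abelian.Ext.zero_comp]

lemma smul_eq_zero_of_target {r : R} (hr : ∀ y : M, r • y = 0) (x : ModuleExt R M i A) :
    r • x = 0 := by
  have : r • 𝟙 (ModuleCat.of R M) = 0 := by
    ext y
    exact hr y
  rw [Abelian.Ext.smul_eq_comp_mk₀, this, Abelian.Ext.mk₀_zero, Abelian.Ext.comp_zero]

instance subsingleton [Subsingleton A] : Subsingleton (ModuleExt R M i A) := by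
  refine ⟨fun x y => ?_⟩
  rw [← one_smul R x, ← one_smul R y, smul_eq_zero_of_source M i (fun _ => Subsingleton.elim _ _),
    smul_eq_zero_of_source M i (fun _ => Subsingleton.elim _ _)]

/-- A short exact sequence of modules, as a short complex. -/
def shortComplex {f : A →ₗ[R] B} {g : B →ₗ[R] C} (h : Function.Exact f g) :
    ShortComplex (ModuleCat.{u} R) :=
  ShortComplex.moduleCatMk f g h.linearMap_comp_eq_zero

variable {f : A →ₗ[R] B} {g : B →ₗ[R] C} (h : Function.Exact f g)
  (hf : Function.Injective f) (hg : Function.Surjective g)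

include hf hg in
lemma shortExact : (shortComplex h).ShortExact :=
  ModuleCat.shortComplex_shortExact _ h hf hg

/-- The connecting homomorphism. -/
noncomputable def δ : ModuleExt R M i A →ₗ[R] ModuleExt R M (i + 1) C :=
  Abelian.Ext.bilinearCompOfLinear R _ _ _ 1 i (i + 1) (add_comm 1 i)
    (shortExact h hf hg).extClass

lemma δ_apply (x : ModuleExt R M i A) :
    δ M i h hf hg x = (shortExact h hf hg).extClass.comp x (add_comm 1 i) := rfl

include h hf hg in
lemma exact_map_map : Function.Exact (map M i g) (map M i f) := by
  intro x
  refine ⟨Abelian.Ext.contravariant_sequence_exact₂ (shortExact h hf hg) _ x, ?_⟩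
  rintro ⟨y, rfl⟩
  have h0 : ModuleCat.ofHom (0 : A →ₗ[R] C) = 0 := rfl
  rw [map_map, h.linearMap_comp_eq_zero, map_apply, h0, Abelian.Ext.mk₀_zero,
    Abelian.Ext.zero_comp]

lemma exact_map_δ : Function.Exact (map M i f) (δ M i h hf hg) := by
  intro x
  refine ⟨Abelian.Ext.contravariant_sequence_exact₁ (shortExact h hf hg) _ x (add_comm 1 i), ?_⟩
  rintro ⟨y, rfl⟩
  exact (shortExact h hf hg).extClass_comp_assoc y (h := add_comm 1 i)

lemma exact_δ_map : Function.Exact (δ M i h hf hg) (map M (i + 1) g) := by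
  intro x
  refine ⟨fun hx => Abelian.Ext.contravariant_sequence_exact₃ (shortExact h hf hg) _ x hx (add_comm 1 i), ?_⟩
  rintro ⟨y, rfl⟩
  exact (shortExact h hf hg).comp_extClass_assoc y (add_comm 1 i)

include hg in
lemma map_zero_injective : Function.Injective (map M 0 g) :=
  have : Epi (ModuleCat.ofHom g) := (ModuleCat.epi_iff_surjective _).2 hg
  Abelian.Ext.precomp_mk₀_injective_of_epi (ModuleCat.of R M) (ModuleCat.ofHom g)

variable {A' B' C' : Type u} [AddCommGroup A'] [AddCommGroup B'] [AddCommGroup C']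
  [Module R A'] [Module R B'] [Module R C']
  {f' : A' →ₗ[R] B'} {g' : B' →ₗ[R] C'} (h' : Function.Exact f' g')
  (hf' : Function.Injective f') (hg' : Function.Surjective g')

lemma δ_naturality (α : A →ₗ[R] A') (β : B →ₗ[R] B') (γ : C →ₗ[R] C')
    (h₁ : β ∘ₗ f = f' ∘ₗ α) (h₂ : γ ∘ₗ g = g' ∘ₗ β) (x : ModuleExt R M i A') :
    δ M i h hf hg (map M i α x) = map M (i + 1) γ (δ M i h' hf' hg' x) := by
  let φ : shortComplex h ⟶ shortComplex h' :=
    { τ₁ := ModuleCat.ofHom α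
      τ₂ := ModuleCat.ofHom β
      τ₃ := ModuleCat.ofHom γ
      comm₁₂ := ModuleCat.hom_ext h₁.symm
      comm₂₃ := ModuleCat.hom_ext h₂.symm }
  have key := ShortComplex.ShortExact.extClass_naturality (shortExact h hf hg)
    (shortExact h' hf' hg') φ
  have e₁ := Abelian.Ext.comp_assoc (shortExact h hf hg).extClass
    (Abelian.Ext.mk₀ (ModuleCat.ofHom α)) x (add_zero 1) (zero_add i)
    (show 1 + 0 + i = i + 1 by omega)
  have e₂ := Abelian.Ext.comp_assoc (Abelian.Ext.mk₀ (ModuleCat.ofHom γ))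
    (shortExact h' hf' hg').extClass x (zero_add 1) (add_comm 1 i)
    (show 0 + 1 + i = i + 1 by omega)
  rw [δ_apply, map_apply, map_apply, δ_apply]
  exact e₁.symm.trans ((congrArg (fun y => Abelian.Ext.comp y x (add_comm 1 i)) key).trans e₂)

variable [IsNoetherianRing R] [Module.Finite R M]

lemma isFiniteLength [Module.Finite R A] (b : Ideal R)
    (hb : ∀ r ∈ b, ∀ x : A, r • x = 0)
    (hart : IsArtinianRing (R ⧸ (b + Module.annihilator R M))) :
    IsFiniteLength R (ModuleExt R M i A) := by
  have : Module.Finite R (ModuleExt R M i A) :=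
    ModuleCat.finite_ext R (ModuleCat.of R A) (ModuleCat.of R M) i
  have htor : Module.IsTorsionBySet R (ModuleExt R M i A)
      (b + Module.annihilator R M : Ideal R) := by
    rintro x ⟨r, hr⟩
    obtain ⟨r₁, h₁, r₂, h₂, rfl⟩ := Submodule.mem_sup.1 hr
    change (r₁ + r₂) • x = 0
    rw [add_smul, smul_eq_zero_of_source M i (hb r₁ h₁),
      smul_eq_zero_of_target M i (Module.mem_annihilator.1 h₂), add_zero]
  let : Module (R ⧸ (b + Module.annihilator R M)) (ModuleExt R M i A) := htor.module
  have : IsScalarTower R (R ⧸ (b + Module.annihilator R M)) (ModuleExt R M i A) :=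
    htor.isScalarTower
  have : Module.Finite (R ⧸ (b + Module.annihilator R M)) (ModuleExt R M i A) :=
    Module.Finite.of_restrictScalars_finite R _ _
  have : IsArtinian (R ⧸ (b + Module.annihilator R M)) (ModuleExt R M i A) := inferInstance
  have : IsArtinian R (ModuleExt R M i A) :=
    (LinearMap.isArtinian_iff_of_bijective (σ := Ideal.Quotient.mk _)
      { toFun := id, map_add' := fun _ _ => rfl, map_smul' := fun _ _ => rfl }
      Function.bijective_id).2 this
  exact isFiniteLength_iff_isNoetherian_isArtinian.2 ⟨inferInstance, this⟩

end

end ModuleExt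

/-! ### Raising modules -/

/-- A sequence of `R`-modules with commuting operators of degree `1`: a graded module over the
polynomial ring `R[ι]`. -/
structure RaisingModule (R : Type u) [CommRing R] (ι : Type w) where
  /-- The component of a given degree. -/
  X : ℕ → Type u
  [addCommGroup : ∀ n, AddCommGroup (X n)]
  [module : ∀ n, Module R (X n)]
  /-- The action of the variables. -/
  T : ι → ∀ n, X n →ₗ[R] X (n + 1)
  comm : ∀ a b n x, T a (n + 1) (T b n x) = T b (n + 1) (T a n x)

namespace RaisingModule

attribute [instance] RaisingModule.addCommGroup RaisingModule.module

variable {R : Type u} [CommRing R] {ι : Type w}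

/-- Graded submodules stable under the operators indexed by `s`. -/
def Stable (G : RaisingModule R ι) (s : Finset ι) : Type _ :=
  {Z : ∀ n, Submodule R (G.X n) // ∀ a ∈ s, ∀ n, Z n ≤ (Z (n + 1)).comap (G.T a n)}

instance (G : RaisingModule R ι) (s : Finset ι) : PartialOrder (G.Stable s) :=
  inferInstanceAs (PartialOrder
    {Z : ∀ n, Submodule R (G.X n) // ∀ a ∈ s, ∀ n, Z n ≤ (Z (n + 1)).comap (G.T a n)})

lemma Stable.map_mem {G : RaisingModule R ι} {s : Finset ι} (Z : G.Stable s) {a : ι}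
    (ha : a ∈ s) {n : ℕ} {x : G.X n} (hx : x ∈ Z.1 n) : G.T a n x ∈ Z.1 (n + 1) :=
  Z.2 a ha n hx

/-- The ascending chain condition on graded submodules stable under `s`. -/
def IsNoeth (G : RaisingModule R ι) (s : Finset ι) : Prop := WellFoundedGT (G.Stable s)

/-- The kernels of one of the operators. -/
def ker (G : RaisingModule R ι) (a : ι) : RaisingModule R ι where
  X n := LinearMap.ker (G.T a n)
  T b n := (G.T b n).restrict fun x hx => by
    rw [LinearMap.mem_ker] at hx ⊢
    rw [G.comm, hx, map_zero]
  comm b c n x := Subtype.ext (G.comm b c n x)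

/-- The ranges of one of the operators. -/
def range (G : RaisingModule R ι) (a : ι) : RaisingModule R ι where
  X n := LinearMap.range (G.T a n)
  T b n := (G.T b (n + 1)).restrict (by
    rintro _ ⟨x, rfl⟩
    exact ⟨G.T b n x, G.comm _ _ _ _⟩)
  comm b c n x := Subtype.ext (G.comm b c (n + 1) x)

/-- The cokernels of one of the operators, omitting degree zero. -/
def cokerShift (G : RaisingModule R ι) (a : ι) : RaisingModule R ι where
  X n := G.X (n + 1) ⧸ LinearMap.range (G.T a n)
  T b n := Submodule.mapQ _ _ (G.T b (n + 1)) (by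
    rintro _ ⟨x, rfl⟩
    exact ⟨G.T b n x, G.comm _ _ _ _⟩)
  comm b c n x := by
    obtain ⟨x, rfl⟩ := Submodule.mkQ_surjective _ x
    exact congrArg (Submodule.mkQ _) (G.comm b c (n + 1) x)

/-- Degreewise `Ext` into a fixed module. -/
noncomputable def ext (G : RaisingModule R ι) (M : Type u) [AddCommGroup M] [Module R M]
    (i : ℕ) : LoweringModule.{u} R ι where
  X n := ModuleExt R M i (G.X n)
  T a n := ModuleExt.map M i (G.T a n)
  comm a b n x := by
    rw [ModuleExt.map_map, ModuleExt.map_map]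
    exact congrArg (fun f => ModuleExt.map M i f x) (LinearMap.ext fun y => G.comm b a n y)

variable {G : RaisingModule R ι} {s : Finset ι} {a : ι}

section

variable [DecidableEq ι]

lemma IsNoeth.ker (hG : G.IsNoeth (insert a s)) : (G.ker a).IsNoeth s := by
  have : WellFoundedGT (G.Stable (insert a s)) := hG
  let e : (G.ker a).Stable s → G.Stable (insert a s) := fun Z =>
    ⟨fun n => (Z.1 n).map (LinearMap.ker (G.T a n)).subtype, by
      rintro b hb n _ ⟨x, hx, rfl⟩
      rcases Finset.mem_insert.1 hb with rfl | hb
      · have h0 : G.T b n x.1 = 0 := x.2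
        change G.T b n x.1 ∈ (Z.1 (n + 1)).map (LinearMap.ker (G.T b (n + 1))).subtype
        rw [h0]
        exact zero_mem _
      · exact ⟨_, Z.2 b hb n hx, rfl⟩⟩
  have he : StrictMono e := by
    refine Monotone.strictMono_of_injective (fun Z Z' h n => Submodule.map_mono (h n))
      fun Z Z' hZ => Subtype.ext (funext fun n => ?_)
    exact Submodule.map_injective_of_injective (Submodule.subtype_injective _)
      (congrFun (congrArg Subtype.val hZ) n)
  exact he.wellFoundedGT

lemma IsNoeth.cokerShift (hG : G.IsNoeth (insert a s)) : (G.cokerShift a).IsNoeth s := by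
  have : WellFoundedGT (G.Stable (insert a s)) := hG
  let e : (G.cokerShift a).Stable s → G.Stable (insert a s) := fun Z =>
    ⟨fun n => match n with
      | 0 => ⊥
      | n + 1 => (Z.1 n).comap (LinearMap.range (G.T a n)).mkQ, by
        rintro b hb (_ | n) x hx
        · rw [(Submodule.mem_bot R).1 hx]
          exact zero_mem _
        · rcases Finset.mem_insert.1 hb with rfl | hb
          · have h0 : (LinearMap.range (G.T b (n + 1))).mkQ (G.T b (n + 1) x) = 0 :=
              (Submodule.Quotient.mk_eq_zero _).2 ⟨x, rfl⟩
            change (LinearMap.range (G.T b (n + 1))).mkQ (G.T b (n + 1) x) ∈ Z.1 (n + 1)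
            rw [h0]
            exact zero_mem _
          · exact Z.2 b hb n hx⟩
  have he : StrictMono e := by
    refine Monotone.strictMono_of_injective ?_ fun Z Z' hZ => Subtype.ext (funext fun n => ?_)
    · rintro Z Z' h (_ | n)
      · exact le_rfl
      · exact Submodule.comap_mono (h n)
    · exact Submodule.comap_injective_of_surjective (Submodule.mkQ_surjective _)
        (congrFun (congrArg Subtype.val hZ) (n + 1))
  exact he.wellFoundedGT

end

lemma IsNoeth.eventually_subsingleton (hG : G.IsNoeth ∅) :
    ∃ N, ∀ n ≥ N, Subsingleton (G.X n) := by
  have : WellFoundedGT (G.Stable ∅) := hG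
  let Z : ℕ → G.Stable ∅ := fun k =>
    ⟨fun n => if n < k then ⊤ else ⊥, fun a ha => absurd ha (Finset.notMem_empty a)⟩
  have hZ : Monotone Z := by
    intro k l h n
    change (if n < k then (⊤ : Submodule R (G.X n)) else ⊥) ≤ if n < l then ⊤ else ⊥
    split_ifs <;> first | exact bot_le | exact le_top | omega
  obtain ⟨N, hN⟩ := WellFoundedGT.monotone_chain_condition ⟨Z, hZ⟩
  refine ⟨N, fun n hn => ?_⟩
  have h : (if n < N then (⊤ : Submodule R (G.X n)) else ⊥) = if n < n + 1 then ⊤ else ⊥ :=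
    congrFun (congrArg Subtype.val (hN (n + 1) (by omega))) n
  rw [if_neg (by omega), if_pos (by omega)] at h
  exact (Submodule.subsingleton_iff R).1 (subsingleton_of_bot_eq_top h)

variable {M : Type u} [AddCommGroup M] [Module R M]

section

variable {P Q : RaisingModule R ι} (π : ∀ n, Q.X n →ₗ[R] P.X n)
  (hπ : ∀ a n x, P.T a n (π n x) = π (n + 1) (Q.T a n x))

include hπ in
lemma map_map_comm (a : ι) (n i : ℕ) (x : ModuleExt R M i (P.X (n + 1))) :
    ModuleExt.map M i (π n) (ModuleExt.map M i (P.T a n) x) =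
      ModuleExt.map M i (Q.T a n) (ModuleExt.map M i (π (n + 1)) x) := by
  rw [ModuleExt.map_map, ModuleExt.map_map]
  exact congrArg (fun f => ModuleExt.map M i f x) (LinearMap.ext fun y => hπ a n y)

variable (M) in
/-- The kernels of the maps on `Ext` induced by a morphism. -/
noncomputable def extKer (i : ℕ) : LoweringModule.{u} R ι :=
  (P.ext M i).sub (fun n => LinearMap.ker (ModuleExt.map M i (π n))) fun a n x hx =>
    (map_map_comm π hπ a n i x).trans
      ((congrArg (ModuleExt.map M i (Q.T a n)) hx).trans (map_zero _))

/-- The kernels of the maps on `Ext` induced by a surjective morphism are controlled by `Ext` of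
the kernel of the morphism. -/
lemma isArt_extKer (ρ : ∀ n, G.X n →ₗ[R] Q.X n)
    (hρ : ∀ a n x, Q.T a n (ρ n x) = ρ (n + 1) (G.T a n x))
    (hex : ∀ n, Function.Exact (ρ n) (π n)) (hinj : ∀ n, Function.Injective (ρ n))
    (hsurj : ∀ n, Function.Surjective (π n)) (hG : ∀ i, (G.ext M i).IsArt s) (i : ℕ) :
    (extKer M π hπ i).IsArt s := by
  cases i with
  | zero =>
    have hsub (n : ℕ) : Subsingleton ((extKer M π hπ 0).X n) := by
      change Subsingleton (LinearMap.ker (ModuleExt.map M 0 (π n)))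
      rw [LinearMap.ker_eq_bot.2 (ModuleExt.map_zero_injective M (hsurj n))]
      infer_instance
    exact LoweringModule.isArt_zero.of_surjective (fun _ => 0)
      (fun _ _ _ => (map_zero _).symm) fun n x => ⟨0, (hsub n).elim _ _⟩
  | succ i =>
    let f (n : ℕ) : (G.ext M i).X n →ₗ[R] (extKer M π hπ (i + 1)).X n :=
      LinearMap.codRestrict (LinearMap.ker (ModuleExt.map M (i + 1) (π n)))
        (ModuleExt.δ M i (hex n) (hinj n) (hsurj n)) fun x =>
        (ModuleExt.exact_δ_map M i (hex n) (hinj n) (hsurj n)).apply_apply_eq_zero x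
    refine (hG i).of_surjective f (fun b n x => Subtype.ext ?_) fun n x => ?_
    · exact ModuleExt.δ_naturality M i (hex n) (hinj n) (hsurj n) (hex (n + 1)) (hinj (n + 1))
        (hsurj (n + 1)) (G.T b n) (Q.T b n) (P.T b n)
        (LinearMap.ext fun y => hρ b n y) (LinearMap.ext fun y => hπ b n y) x
    · obtain ⟨y, hy⟩ := (ModuleExt.exact_δ_map M i (hex n) (hinj n) (hsurj n) x.1).1 x.2
      exact ⟨y, Subtype.ext hy⟩

end

/-- The kernels of `Ext` of the surjections onto the ranges of an operator. -/
noncomputable def extRangeKer (G : RaisingModule R ι) (a : ι) (M : Type u) [AddCommGroup M]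
    [Module R M] (i : ℕ) : LoweringModule.{u} R ι :=
  extKer (P := G.range a) (Q := G) M (fun n => (G.T a n).rangeRestrict)
    (fun b n x => Subtype.ext (G.comm b a n x)) i

lemma exact_ker (a : ι) (n : ℕ) :
    Function.Exact (LinearMap.ker (G.T a n)).subtype (G.T a n).rangeRestrict :=
  LinearMap.exact_iff.2 (by simp)

lemma isArt_extRangeKer (hker : ∀ i, ((G.ker a).ext M i).IsArt s) (i : ℕ) :
    (G.extRangeKer a M i).IsArt s :=
  isArt_extKer (G := G.ker a) (P := G.range a) (Q := G) (fun n => (G.T a n).rangeRestrict)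
    (fun b n x => Subtype.ext (G.comm b a n x)) (fun n => (LinearMap.ker (G.T a n)).subtype)
    (fun _ _ _ => rfl) (exact_ker a)
    (fun _ => Submodule.subtype_injective _) (fun n => (G.T a n).surjective_rangeRestrict)
    hker i

lemma map_rangeRestrict_map_subtype (n i : ℕ) (x : ModuleExt R M i (G.X (n + 1))) :
    ModuleExt.map M i (G.T a n).rangeRestrict
        (ModuleExt.map M i (LinearMap.range (G.T a n)).subtype x) =
      ModuleExt.map M i (G.T a n) x :=
  ModuleExt.map_map M i _ _ x

lemma exact_range (a : ι) (n : ℕ) : Function.Exact (LinearMap.range (G.T a n)).subtype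
    (LinearMap.range (G.T a n)).mkQ := LinearMap.exact_iff.2 (by simp)

lemma exact_map_range (a : ι) (n i : ℕ) :
    Function.Exact (ModuleExt.map M i (LinearMap.range (G.T a n)).mkQ)
      (ModuleExt.map M i (LinearMap.range (G.T a n)).subtype) :=
  ModuleExt.exact_map_map M i (exact_range a n) (Submodule.subtype_injective _)
    (Submodule.mkQ_surjective _)

lemma map_map_mkQ (n i : ℕ) (x : ModuleExt R M i (G.X (n + 1) ⧸ LinearMap.range (G.T a n))) :
    ModuleExt.map M i (G.T a n) (ModuleExt.map M i (LinearMap.range (G.T a n)).mkQ x) = 0 := by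
  rw [← map_rangeRestrict_map_subtype, (exact_map_range a n i).apply_apply_eq_zero, map_zero]

/-- `Ext` of the cokernels of an operator mapping to the kernels on `Ext`. -/
noncomputable def extCokerToKer (G : RaisingModule R ι) (a : ι) (M : Type u) [AddCommGroup M]
    [Module R M] (i n : ℕ) :
    ((G.cokerShift a).ext M i).X n →ₗ[R] ((G.ext M i).kerShift a).X n :=
  LinearMap.codRestrict (LinearMap.ker (ModuleExt.map M i (G.T a n)))
    (ModuleExt.map M i (LinearMap.range (G.T a n)).mkQ) (map_map_mkQ n i)

/-- The kernels of an operator on `Ext` mapping to `Ext` of the ranges. -/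
noncomputable def extKerToRange (G : RaisingModule R ι) (a : ι) (M : Type u) [AddCommGroup M]
    [Module R M] (i n : ℕ) :
    ((G.ext M i).kerShift a).X n →ₗ[R] (G.extRangeKer a M i).X n :=
  LinearMap.restrict (p := LinearMap.ker (ModuleExt.map M i (G.T a n)))
    (q := LinearMap.ker (ModuleExt.map M i (G.T a n).rangeRestrict))
    (ModuleExt.map M i (LinearMap.range (G.T a n)).subtype) fun x hx =>
      (map_rangeRestrict_map_subtype n i x).trans hx

lemma isArt_kerShift_ext (hker : ∀ i, ((G.ker a).ext M i).IsArt s)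
    (hcoker : ∀ i, ((G.cokerShift a).ext M i).IsArt s) (i : ℕ) :
    ((G.ext M i).kerShift a).IsArt s := by
  refine (hcoker i).of_exact (isArt_extRangeKer hker i)
    (G.extCokerToKer a M i) (G.extKerToRange a M i)
    (fun b n x => Subtype.ext ?_) (fun b n x => Subtype.ext ?_) fun n x hx => ?_
  · exact (ModuleExt.map_map M i (LinearMap.range (G.T a n)).mkQ
      ((G.cokerShift a).T b n) x).trans (ModuleExt.map_map M i (G.T b (n + 1))
        (LinearMap.range (G.T a (n + 1))).mkQ x).symm
  · exact (ModuleExt.map_map M i (LinearMap.range (G.T a n)).subtype (G.T b (n + 1)) x.1).trans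
      (ModuleExt.map_map M i ((G.range a).T b n)
        (LinearMap.range (G.T a (n + 1))).subtype x.1).symm
  · obtain ⟨y, hy⟩ := (exact_map_range a n i x.1).1 (congrArg Subtype.val hx)
    exact ⟨y, Subtype.ext hy⟩

/-- Degreewise `Ext` turns the ascending chain condition into the descending one. -/
theorem IsNoeth.isArt_ext [DecidableEq ι] [IsNoetherianRing R] [Module.Finite R M] (b : Ideal R)
    (hart : IsArtinianRing (R ⧸ (b + Module.annihilator R M)))
    (hG : G.IsNoeth s) (hfin : ∀ n, Module.Finite R (G.X n))
    (hb : ∀ n, ∀ r ∈ b, ∀ x : G.X n, r • x = 0) (i : ℕ) : (G.ext M i).IsArt s := by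
  have hext {G : RaisingModule R ι} (hfin : ∀ n, Module.Finite R (G.X n))
      (hb : ∀ n, ∀ r ∈ b, ∀ x : G.X n, r • x = 0) (i n : ℕ) : IsArtinian R ((G.ext M i).X n) :=
    (isFiniteLength_iff_isNoetherian_isArtinian.1
      (ModuleExt.isFiniteLength M i b (hb n) hart)).2
  induction s using Finset.induction_on generalizing G i with
  | empty =>
    obtain ⟨N, hN⟩ := hG.eventually_subsingleton
    have := hext hfin hb i
    refine LoweringModule.isArt_of_eventually_subsingleton N fun n hn => ?_
    have := hN n hn
    exact ModuleExt.subsingleton M i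
  | insert a s _ ih =>
    have := hext hfin hb i 0
    refine LoweringModule.IsArt.of_kerShift (isArt_kerShift_ext (ih hG.ker ?_ ?_)
      (ih hG.cokerShift ?_ ?_) i)
    · exact fun n => inferInstanceAs (Module.Finite R (LinearMap.ker (G.T a n)))
    · exact fun n r hr x => Subtype.ext (hb n r hr x.1)
    · exact fun n => inferInstanceAs (Module.Finite R (G.X (n + 1) ⧸ LinearMap.range (G.T a n)))
    · intro n r hr x
      obtain ⟨x, rfl⟩ := Submodule.mkQ_surjective _ x
      exact (congrArg (Submodule.mkQ _) (hb (n + 1) r hr x)).trans (map_zero _)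

end RaisingModule

/-! ### The adic filtration -/

section Adic

variable {R : Type u} [CommRing R] (I : Ideal R) (N : Type u) [AddCommGroup N] [Module R N]

/-- Multiplication by an element of `I`, as a map `N/IⁿN → N/Iⁿ⁺¹N`. -/
def adicMul (a : I) (n : ℕ) :
    N ⧸ (I ^ n • ⊤ : Submodule R N) →ₗ[R] N ⧸ (I ^ (n + 1) • ⊤ : Submodule R N) :=
  Submodule.mapQ _ _ (LinearMap.lsmul R N a) (by
    rw [← Submodule.map_le_iff_le_comap, pow_succ', Submodule.mul_smul]
    rintro _ ⟨x, hx, rfl⟩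
    exact Submodule.smul_mem_smul a.2 hx)

lemma adicMul_mkQ (a : I) (n : ℕ) (x : N) :
    adicMul I N a n (Submodule.mkQ _ x) = Submodule.mkQ _ (a.1 • x) := rfl

/-- The projection `N/Iⁿ⁺¹N → N/IⁿN`. -/
def adicProj (n : ℕ) :
    N ⧸ (I ^ (n + 1) • ⊤ : Submodule R N) →ₗ[R] N ⧸ (I ^ n • ⊤ : Submodule R N) :=
  Submodule.factor (show (I ^ (n + 1) • ⊤ : Submodule R N) ≤ I ^ n • ⊤ from
    Submodule.smul_mono_left (Ideal.pow_le_pow_right (Nat.le_succ n)))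

lemma adicProj_mkQ (n : ℕ) (x : N) :
    adicProj I N n (Submodule.mkQ _ x) = Submodule.mkQ _ x := rfl

lemma adicProj_surjective (n : ℕ) : Function.Surjective (adicProj I N n) :=
  fun x => by
    obtain ⟨x, rfl⟩ := Submodule.mkQ_surjective _ x
    exact ⟨Submodule.mkQ _ x, rfl⟩

lemma adicMul_adicProj (a : I) (n : ℕ) (x) :
    adicMul I N a n (adicProj I N n x) = adicProj I N (n + 1) (adicMul I N a (n + 1) x) := by
  obtain ⟨x, rfl⟩ := Submodule.mkQ_surjective _ x
  rw [adicProj_mkQ, adicMul_mkQ, adicMul_mkQ, adicProj_mkQ]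

/-- The modules `N/IⁿN`. -/
def adicQuotient : RaisingModule R I where
  X n := N ⧸ (I ^ n • ⊤ : Submodule R N)
  T := adicMul I N
  comm a b n x := by
    obtain ⟨x, rfl⟩ := Submodule.mkQ_surjective _ x
    rw [adicMul_mkQ, adicMul_mkQ, adicMul_mkQ, adicMul_mkQ, smul_comm]

/-- The modules `N/Iⁿ⁺¹N`. -/
def adicQuotientSucc : RaisingModule R I where
  X n := N ⧸ (I ^ (n + 1) • ⊤ : Submodule R N)
  T a n := adicMul I N a (n + 1)
  comm a b n x := (adicQuotient I N).comm a b (n + 1) x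

/-- The associated graded module of the `I`-adic filtration. -/
def adicGraded : RaisingModule R I where
  X n := LinearMap.ker (adicProj I N n)
  T a n := (adicMul I N a (n + 1)).restrict fun x hx =>
    (adicMul_adicProj I N a n x).symm.trans ((congrArg _ hx).trans (map_zero _))
  comm a b n x := Subtype.ext ((adicQuotient I N).comm a b (n + 1) x.1)

variable {I N}

/-- The submodule of `N` corresponding to a submodule of a component of the associated graded
module. -/
def adicGradedComap {n : ℕ} (Z : Submodule R (LinearMap.ker (adicProj I N n))) :
    Submodule R N :=
  (Z.map (LinearMap.ker (adicProj I N n)).subtype).comap (Submodule.mkQ _)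

lemma adicGradedComap_injective {n : ℕ} :
    Function.Injective (adicGradedComap (I := I) (N := N) (n := n)) :=
  (Submodule.comap_injective_of_surjective (Submodule.mkQ_surjective _)).comp
    (Submodule.map_injective_of_injective (Submodule.subtype_injective _))

lemma adicGradedComap_le {n : ℕ} (Z : Submodule R (LinearMap.ker (adicProj I N n))) :
    adicGradedComap Z ≤ I ^ n • ⊤ := by
  rintro x ⟨y, -, hy⟩
  have h : adicProj I N n (Submodule.mkQ _ x) = 0 := hy ▸ y.2
  exact (Submodule.Quotient.mk_eq_zero _).1 h

lemma le_adicGradedComap {n : ℕ} (Z : Submodule R (LinearMap.ker (adicProj I N n))) :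
    I ^ (n + 1) • ⊤ ≤ adicGradedComap Z := by
  intro x hx
  rw [adicGradedComap, Submodule.mem_comap, Submodule.mkQ_apply,
    (Submodule.Quotient.mk_eq_zero _).2 hx]
  exact zero_mem _

lemma smul_mem_adicGradedComap {s : Finset I} (Z : (adicGraded I N).Stable s) {a : I}
    (ha : a ∈ s) {n : ℕ} {y : N} (hy : y ∈ adicGradedComap (Z.1 n)) :
    a.1 • y ∈ adicGradedComap (Z.1 (n + 1)) := by
  obtain ⟨z, hz, hzy⟩ := hy
  refine ⟨(adicGraded I N).T a n z, Z.map_mem ha hz, ?_⟩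
  rw [← adicMul_mkQ, ← hzy]
  rfl

lemma smul_mem_adicGradedComap_of_span {s : Finset I}
    (hs : Submodule.span R (s : Set I) = ⊤) (Z : (adicGraded I N).Stable s) (a : I)
    {n : ℕ} {y : N} (hy : y ∈ adicGradedComap (Z.1 n)) :
    a.1 • y ∈ adicGradedComap (Z.1 (n + 1)) := by
  have ha : a ∈ Submodule.span R (s : Set I) := hs ▸ Submodule.mem_top
  induction ha using Submodule.span_induction with
  | mem a ha => exact smul_mem_adicGradedComap Z ha hy
  | zero =>
    rw [Submodule.coe_zero, zero_smul]
    exact zero_mem _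
  | add a b _ _ ha hb =>
    rw [Submodule.coe_add, add_smul]
    exact add_mem ha hb
  | smul r a _ ha =>
    rw [Submodule.coe_smul, smul_assoc]
    exact Submodule.smul_mem _ r ha

/-- The filtration of `N` corresponding to a graded submodule of the associated graded module. -/
def adicGradedFiltration {s : Finset I} (hs : Submodule.span R (s : Set I) = ⊤)
    (Z : (adicGraded I N).Stable s) : I.Filtration N where
  N n := adicGradedComap (Z.1 n)
  mono n := (adicGradedComap_le (Z.1 (n + 1))).trans (le_adicGradedComap (Z.1 n))
  smul_le _ := Submodule.smul_le.2 fun a ha _ hy =>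
    smul_mem_adicGradedComap_of_span hs Z ⟨a, ha⟩ hy

lemma Ideal.Filtration.submodule_mono {F F' : I.Filtration N} (h : ∀ n, F.N n ≤ F'.N n) :
    F.submodule ≤ F'.submodule :=
  fun _ hf n => h n (hf n)

lemma Ideal.Filtration.N_eq_of_submodule_eq {F F' : I.Filtration N}
    (h : F.submodule = F'.submodule) (n : ℕ) : F.N n = F'.N n := by
  have key (F : I.Filtration N) (x : N) :
      x ∈ F.N n ↔ PolynomialModule.single R n x ∈ F.submodule := by
    refine ⟨fun hx m => ?_, fun hx => ?_⟩
    · rw [PolynomialModule.coeff_single, Finsupp.single_apply]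
      split_ifs with h
      · exact h ▸ hx
      · exact zero_mem _
    · simpa using hx n
  ext x
  rw [key, key, h]

variable (N) in
/-- The associated graded module of a finite module over a Noetherian ring satisfies the
ascending chain condition. -/
theorem isNoeth_adicGraded [IsNoetherianRing R] [Module.Finite R N] {s : Finset I}
    (hs : Submodule.span R (s : Set I) = ⊤) : (adicGraded I N).IsNoeth s := by
  let F := I.stableFiltration (⊤ : Submodule R N)
  have : Module.Finite (reesAlgebra I) F.submodule := Module.Finite.iff_fg.2
    ((F.submodule_fg_iff_stable fun _ => IsNoetherian.noetherian _).2
      (I.stableFiltration_stable ⊤))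
  have : WellFoundedGT (Submodule (reesAlgebra I) F.submodule) :=
    isNoetherian_iff'.1 (isNoetherian_of_isNoetherianRing_of_finite (reesAlgebra I) F.submodule)
  let e : (adicGraded I N).Stable s → Submodule (reesAlgebra I) F.submodule := fun Z =>
    (adicGradedFiltration hs Z).submodule.comap F.submodule.subtype
  have hle (Z) : (adicGradedFiltration hs Z).submodule ≤ F.submodule :=
    Ideal.Filtration.submodule_mono fun n => adicGradedComap_le (Z.1 n)
  have he : StrictMono e := by
    refine Monotone.strictMono_of_injective (fun Z Z' h => ?_)
      fun Z Z' hZ => Subtype.ext (funext fun n => ?_)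
    · exact Submodule.comap_mono (Ideal.Filtration.submodule_mono fun n =>
        Submodule.comap_mono (Submodule.map_mono (h n)))
    · have h : (adicGradedFiltration hs Z).submodule = (adicGradedFiltration hs Z').submodule := by
        have := congrArg (Submodule.map F.submodule.subtype) hZ
        simpa only [e, Submodule.map_comap_subtype, inf_eq_right.2 (hle _)] using this
      exact adicGradedComap_injective (Ideal.Filtration.N_eq_of_submodule_eq h n)
  exact he.wellFoundedGT

end Adic

/-! ### Lengths of `Ext_R^i(N/IⁿN, M)` -/

section ExtAdic

variable {R : Type u} [CommRing R] (I : Ideal R)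
  (M N : Type u) [AddCommGroup M] [Module R M] [AddCommGroup N] [Module R N]

lemma exact_adicProj (n : ℕ) :
    Function.Exact (LinearMap.ker (adicProj I N n)).subtype (adicProj I N n) :=
  LinearMap.exact_iff.2 (by simp)

lemma smul_adicGraded_eq_zero (n : ℕ) (r : R) (hr : r ∈ I + Module.annihilator R N)
    (x : LinearMap.ker (adicProj I N n)) : r • x = 0 := by
  obtain ⟨a, ha, b, hb, rfl⟩ := Submodule.mem_sup.1 hr
  obtain ⟨x, hx⟩ := x
  obtain ⟨y, rfl⟩ := Submodule.mkQ_surjective _ x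
  refine Subtype.ext ?_
  have hy : y ∈ (I ^ n • ⊤ : Submodule R N) := (Submodule.Quotient.mk_eq_zero _).1 hx
  have h : (a + b) • y ∈ (I ^ (n + 1) • ⊤ : Submodule R N) := by
    rw [add_smul, Module.mem_annihilator.1 hb, add_zero, pow_succ', Submodule.mul_smul]
    exact Submodule.smul_mem_smul ha hy
  exact (Submodule.Quotient.mk_eq_zero _).2 h

lemma map_adicProj_exact (i n : ℕ) :
    Function.Exact (ModuleExt.map M i (adicProj I N n))
      (ModuleExt.map M i (LinearMap.ker (adicProj I N n)).subtype) :=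
  ModuleExt.exact_map_map M i (exact_adicProj I N n) (Submodule.subtype_injective _)
    (adicProj_surjective I N n)

/-- The connecting homomorphisms from `Ext` of the associated graded module. -/
noncomputable def adicδ (i n : ℕ) : ModuleExt R M i (LinearMap.ker (adicProj I N n)) →ₗ[R]
    ModuleExt R M (i + 1) (N ⧸ (I ^ n • ⊤ : Submodule R N)) :=
  ModuleExt.δ M i (exact_adicProj I N n) (Submodule.subtype_injective _)
    (adicProj_surjective I N n)

lemma exact_map_adicδ (i n : ℕ) :
    Function.Exact (ModuleExt.map M i (LinearMap.ker (adicProj I N n)).subtype)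
      (adicδ I M N i n) :=
  ModuleExt.exact_map_δ M i _ _ _

lemma exact_adicδ_map (i n : ℕ) :
    Function.Exact (adicδ I M N i n) (ModuleExt.map M (i + 1) (adicProj I N n)) :=
  ModuleExt.exact_δ_map M i _ _ _

/-- The kernels of the maps on `Ext` induced by the projections `N/Iⁿ⁺¹N → N/IⁿN`. -/
noncomputable def extAdicKer (i : ℕ) : LoweringModule.{u} R I :=
  RaisingModule.extKer (P := adicQuotient I N) (Q := adicQuotientSucc I N) M (adicProj I N)
    (adicMul_adicProj I N) i

variable [IsNoetherianRing R] [Module.Finite R M] [Module.Finite R N]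
  (hart : IsArtinianRing (R ⧸ (I + Module.annihilator R M + Module.annihilator R N)))

include hart

lemma isFiniteLength_ext_adicGraded (i n : ℕ) :
    IsFiniteLength R (ModuleExt R M i (LinearMap.ker (adicProj I N n))) := by
  rw [add_right_comm] at hart
  exact ModuleExt.isFiniteLength M i (I + Module.annihilator R N)
    (smul_adicGraded_eq_zero I N n) hart

/-- The modules `Ext_R^i(N/IⁿN, M)` have finite length. -/
theorem isFiniteLength_ext_adicQuotient (i n : ℕ) :
    IsFiniteLength R (ModuleExt R M i (N ⧸ (I ^ n • ⊤ : Submodule R N))) := by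
  induction n with
  | zero =>
    have : Subsingleton (N ⧸ (I ^ 0 • ⊤ : Submodule R N)) := by
      simp [Submodule.Quotient.subsingleton_iff]
    exact .of_subsingleton
  | succ n ih =>
    have hG := isFiniteLength_ext_adicGraded I M N hart i n
    rw [isFiniteLength_iff_isNoetherian_isArtinian] at ih hG ⊢
    obtain ⟨_, _⟩ := ih
    obtain ⟨_, _⟩ := hG
    have hex := (map_adicProj_exact I M N i n).linearMap_ker_eq.symm
    exact ⟨isNoetherian_of_range_eq_ker _ _ hex, isArtinian_of_range_eq_ker _ _ hex⟩

lemma isArt_ext_adicGraded {s : Finset I} (hs : Submodule.span R (s : Set I) = ⊤) (i : ℕ) :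
    ((adicGraded I N).ext M i).IsArt s := by
  classical
  rw [add_right_comm] at hart
  exact (isNoeth_adicGraded N hs).isArt_ext (I + Module.annihilator R N) hart
    (fun n => inferInstanceAs (Module.Finite R (LinearMap.ker (adicProj I N n))))
    (smul_adicGraded_eq_zero I N) i

lemma isArt_extAdicKer {s : Finset I} (hs : Submodule.span R (s : Set I) = ⊤) (i : ℕ) :
    (extAdicKer I M N i).IsArt s :=
  RaisingModule.isArt_extKer (G := adicGraded I N) (P := adicQuotient I N)
    (Q := adicQuotientSucc I N) (adicProj I N) (adicMul_adicProj I N)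
    (fun n => (LinearMap.ker (adicProj I N n)).subtype) (fun _ _ _ => rfl)
    (exact_adicProj I N) (fun _ => Submodule.subtype_injective _) (adicProj_surjective I N)
    (isArt_ext_adicGraded I M N hart hs) i

lemma length_ext_adicQuotient_succ (i n : ℕ) :
    ((Module.length R
      (ModuleExt R M i (N ⧸ (I ^ (n + 1) • ⊤ : Submodule R N)))).toNat : ℚ) -
      (Module.length R (ModuleExt R M i (N ⧸ (I ^ n • ⊤ : Submodule R N)))).toNat =
    ((adicGraded I N).ext M i).hilbert n - (extAdicKer I M N (i + 1)).hilbert n -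
      (extAdicKer I M N i).hilbert n := by
  have key {A B : Type u} [AddCommGroup A] [Module R A] [AddCommGroup B] [Module R B]
      (hA : IsFiniteLength R A) (f : A →ₗ[R] B) : ((Module.length R A).toNat : ℚ) =
        (Module.length R (LinearMap.ker f)).toNat + (Module.length R (LinearMap.range f)).toNat :=
    LoweringModule.hilbert_add_of_exact hA (LinearMap.ker f).subtype f.rangeRestrict
      (Submodule.subtype_injective _) f.surjective_rangeRestrict (LinearMap.exact_iff.2 (by simp))
  have h₁ := key (isFiniteLength_ext_adicQuotient I M N hart i n)
    (ModuleExt.map M i (adicProj I N n))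
  have h₂ := key (isFiniteLength_ext_adicQuotient I M N hart i (n + 1))
    (ModuleExt.map M i (LinearMap.ker (adicProj I N n)).subtype)
  have h₃ := key (isFiniteLength_ext_adicGraded I M N hart i n) (adicδ I M N i n)
  rw [(map_adicProj_exact I M N i n).linearMap_ker_eq] at h₂
  rw [(exact_map_adicδ I M N i n).linearMap_ker_eq,
    ← (exact_adicδ_map I M N i n).linearMap_ker_eq] at h₃
  change _ = (Module.length R (ModuleExt R M i (LinearMap.ker (adicProj I N n)))).toNat -
    ((Module.length R (LinearMap.ker (ModuleExt.map M (i + 1) (adicProj I N n)))).toNat : ℚ) -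
    (Module.length R (LinearMap.ker (ModuleExt.map M i (adicProj I N n)))).toNat
  linarith

/-- The lengths of the modules `Ext_R^i(N/IⁿN, M)` are eventually polynomial in `n`. -/
theorem eventuallyPolynomial_length_ext_adicQuotient (i : ℕ) :
    EventuallyPolynomial fun n =>
      ((Module.length R (ModuleExt R M i (N ⧸ (I ^ n • ⊤ : Submodule R N)))).toNat : ℚ) := by
  classical
  obtain ⟨s, hs⟩ := Module.Finite.fg_top (R := R) (M := I)
  have hker (i : ℕ) : EventuallyPolynomial (extAdicKer I M N i).hilbert :=
    (isArt_extAdicKer I M N hart hs i).eventuallyPolynomial fun n =>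
      (isFiniteLength_ext_adicQuotient I M N hart i n).of_injective
        (Submodule.subtype_injective (LinearMap.ker (ModuleExt.map M i (adicProj I N n))))
  have hG : EventuallyPolynomial ((adicGraded I N).ext M i).hilbert :=
    (isArt_ext_adicGraded I M N hart hs i).eventuallyPolynomial
      (isFiniteLength_ext_adicGraded I M N hart i)
  exact .of_forward_difference (((hG.sub (hker (i + 1))).sub (hker i)).of_eventually_eq 0
    fun n _ => length_ext_adicQuotient_succ I M N hart i n)

end ExtAdic

/-! ### Comparison of the two definitions of `Ext` -/

section Comparison

open Abelian

/-- The homology of a short complex of modules, computed by a linear map on the cycles. -/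
noncomputable def homologyEquivOfSurjective {R : Type u} [CommRing R]
    (S : ShortComplex (ModuleCat.{v} R)) {E : Type w} [AddCommGroup E] [Module R E]
    (φ : LinearMap.ker S.g.hom →ₗ[R] E) (hφ : Function.Surjective φ)
    (hker : LinearMap.range S.moduleCatToCycles = LinearMap.ker φ) : S.homology ≃ₗ[R] E :=
  S.moduleCatHomologyIso.toLinearEquiv ≪≫ₗ
    (Submodule.quotEquivOfEq _ _ hker ≪≫ₗ φ.quotKerEquivOfSurjective hφ)

namespace CategoryTheory.ProjectiveResolution

section

variable {C : Type*} [Category* C] [Abelian C] [HasExt.{w} C] {X Y : C}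
  (P : ProjectiveResolution X)

lemma extMk_eq_zero_iff_of_zero (f : P.complex.X 0 ⟶ Y) (m : ℕ) (hm : 0 + 1 = m)
    (hf : P.complex.d m 0 ≫ f = 0) : P.extMk f m hm hf = 0 ↔ f = 0 := by
  simp only [← P.extEquivCohomologyClass.apply_eq_iff_eq, P.extEquivCohomologyClass_extMk,
    P.extEquivCohomologyClass_zero, CochainComplex.HomComplex.CohomologyClass.mk_eq_zero_iff]
  rw [CochainComplex.HomComplex.Cocycle.toSingleMk_mem_coboundaries_iff _ _ _ _ _ 1 (by lia)]
  have h0 : P.cochainComplex.d (-(0 : ℕ)) 1 = 0 :=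
    (P.cochainComplex.isZero_of_isStrictlyLE 0 1).eq_of_tgt _ _
  simp only [h0, Limits.zero_comp, exists_const]
  constructor
  · intro h
    rw [← cancel_epi (P.cochainComplexXIso (-(0 : ℕ)) 0 rfl).hom, ← h, Limits.comp_zero]
  · rintro rfl
    simp

lemma extMk_eq_zero_iff_exists {i n : ℕ} (hi : (ComplexShape.up ℕ).prev n = i)
    (f : P.complex.X n ⟶ Y) (hf : P.complex.d (n + 1) n ≫ f = 0) :
    P.extMk f (n + 1) rfl hf = 0 ↔ ∃ g : P.complex.X i ⟶ Y, P.complex.d n i ≫ g = f := by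
  cases n with
  | zero =>
    obtain rfl : i = 0 := by rw [← hi, CochainComplex.prev_nat_zero]
    rw [P.extMk_eq_zero_iff_of_zero f _ rfl hf, P.complex.shape 0 0 (by simp)]
    simp [eq_comm]
  | succ n =>
    obtain rfl : i = n := by rw [← hi, CochainComplex.prev_nat_succ]
    exact P.extMk_eq_zero_iff f _ rfl hf i rfl

end

variable {R : Type u} [CommRing R] {X Y : ModuleCat.{u} R} (P : ProjectiveResolution X)

lemma smul_extMk {n : ℕ} (r : R) (f : P.complex.X n ⟶ Y) (m : ℕ) (hm : n + 1 = m)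
    (hf : P.complex.d m n ≫ f = 0) :
    r • P.extMk f m hm hf =
      P.extMk (r • f) m hm (by rw [Linear.comp_smul, hf, smul_zero]) := by
  rw [Abelian.Ext.smul_eq_comp_mk₀, P.extMk_comp_mk₀]
  congr 1

/-- The class in `Ext` of a cocycle. -/
noncomputable def cocycleToExt (i n : ℕ) :
    LinearMap.ker ((P.complex.linearYonedaObj R Y).sc' i n (n + 1)).g.hom →ₗ[R]
      Abelian.Ext X Y n where
  toFun x := P.extMk (Y := Y) x.1 (n + 1) rfl x.2
  map_add' _ _ := (P.add_extMk _ _ _ _ _ _).symm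
  map_smul' r x := (P.smul_extMk r x.1 (n + 1) rfl x.2).symm

lemma cocycleToExt_surjective (i n : ℕ) :
    Function.Surjective (P.cocycleToExt (Y := Y) i n) := by
  intro α
  obtain ⟨f, hf, h⟩ := P.extMk_surjective α (n + 1) rfl
  exact ⟨⟨f, hf⟩, h⟩

lemma range_eq_ker_cocycleToExt (n : ℕ) :
    LinearMap.range ((P.complex.linearYonedaObj R Y).sc' ((ComplexShape.up ℕ).prev n) n
      (n + 1)).moduleCatToCycles = LinearMap.ker (P.cocycleToExt (Y := Y) _ n) := by
  ext x
  refine Iff.trans ?_ (P.extMk_eq_zero_iff_exists (Y := Y) rfl x.1 x.2).symm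
  exact exists_congr fun y => Subtype.ext_iff

/-- The comparison of the two definitions of `Ext`. -/
noncomputable def extLinearEquiv (n : ℕ) :
    ((Ext R (ModuleCat.{u} R) n).obj (Opposite.op X)).obj Y ≃ₗ[R] Abelian.Ext X Y n :=
  (P.isoExt n Y ≪≫ HomologicalComplex.homologyIsoSc' _ _ n (n + 1) rfl (by simp)).toLinearEquiv ≪≫ₗ
    homologyEquivOfSurjective _ (P.cocycleToExt _ n) (P.cocycleToExt_surjective _ n)
      (P.range_eq_ker_cocycleToExt n)

end CategoryTheory.ProjectiveResolution

end Comparison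

lemma moduleLength_eq_length (R M : Type*) [Ring R] [AddCommGroup M] [Module R M] :
    moduleLength R M = Module.length R M :=
  (Module.coe_length R M).symm

/-- The comparison of the two definitions of `Ext` of modules. -/
noncomputable def extModuleEquiv (R : Type u) [CommRing R] (i : ℕ) (A B : Type u)
    [AddCommGroup A] [Module R A] [AddCommGroup B] [Module R B] :
    extModule R i A B ≃ₗ[R] ModuleExt R B i A :=
  (ProjectiveResolution.of (ModuleCat.of R A)).extLinearEquiv i

/-- Corollary 6(a). Let `R` be a commutative Noetherian ring, `I` an
ideal, and `M`, `N` finitely generated `R`-modules such that `R/(I + ann M + ann N)` is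
Artinian.  Then for every `i ≥ 0` and every `n ≥ 1` the module `Ext_R^i(N/IⁿN, M)` has
finite length, and for each `i` there is a polynomial `pᵢ ∈ ℚ[X]` with
`λ(Ext_R^i(N/IⁿN, M)) = pᵢ(n)` for all `n ≫ 0`. -/
theorem stmt_12 {R : Type u} [CommRing R] [IsNoetherianRing R] (I : Ideal R)
    (M N : Type u) [AddCommGroup M] [Module R M] [Module.Finite R M]
    [AddCommGroup N] [Module R N] [Module.Finite R N]
    (hart : IsArtinianRing
      (R ⧸ (I + Module.annihilator R M + Module.annihilator R N))) :
    ∀ i : ℕ,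
      (∀ n : ℕ, 1 ≤ n →
        IsFiniteLength R (extModule R i (N ⧸ (I ^ n • ⊤ : Submodule R N)) M)) ∧
      ∃ (p : Polynomial ℚ) (N₀ : ℕ), ∀ n ≥ N₀, ∃ ℓ : ℕ,
        moduleLength R (extModule R i (N ⧸ (I ^ n • ⊤ : Submodule R N)) M) = ℓ ∧
        (ℓ : ℚ) = p.eval (n : ℚ) := by
  intro i
  refine ⟨fun n _ => ?_, ?_⟩
  · exact (isFiniteLength_ext_adicQuotient I M N hart i n).of_injective
      (extModuleEquiv R i _ M).injective
  · obtain ⟨p, N₀, hp⟩ := eventuallyPolynomial_length_ext_adicQuotient I M N hart i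
    refine ⟨p, N₀, fun n hn => ⟨_, ?_, hp n hn⟩⟩
    rw [moduleLength_eq_length, (extModuleEquiv R i _ M).length_eq]
    exact congrArg _ (ENat.natCast_toNat (Module.length_ne_top_iff.2
      (isFiniteLength_ext_adicQuotient I M N hart i n))).symm
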